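/- Let n ≥ 1, let w_1,…,w_n > 0, let λ : [0,∞) → [0,∞) be measurable and Lebesgue-integrable on compact intervals, and set Λ(x) = ∫₀^x λ(t) dt. On a probability space, for each i = 1,…,n let X_i and C_i be independent random variables with values in (0,∞] such that P(X_i > t) = exp(−Λ(t)·w_i) for all t ≥ 0 and such that each C_i has the same distribution as a random variable C. Define T_i = min(X_i, C_i), Δ_i = 1{X_i ≤ C_i}, and Φ*(t) = (1/n) Σ_{j=1}^n w_j·exp(−Λ(t)·w_j)·P(C ≥ t). Then for every x ≥ 0 with P(C ≥ x) > 0, the following two identities hold: (i) (1/n) Σ_{i=1}^n E[ Δ_i·1{T_i ≤ x} / Φ*(T_i) ] = Λ(x); (ii) the averaged sub-distribution function H*(x) = (1/n) Σ_{i=1}^n P(T_i ≤ x, Δ_i = 1) satisfies H*(x) = ∫₀^x λ(t)·Φ*(t) dt. -/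

import Mathlib

open MeasureTheory ProbabilityTheory Real
open scoped ENNReal ProbabilityTheory

lemma cumhaz_mono {lam Λ : ℝ → ℝ} (hlam_nonneg : ∀ t, 0 ≤ lam t)
    (hlam_int : ∀ a b : ℝ, IntervalIntegrable lam volume a b)
    (hΛ : ∀ x, Λ x = ∫ t in (0:ℝ)..x, lam t) : Monotone Λ := by
  intro a b hab
  have h := intervalIntegral.integral_add_adjacent_intervals (hlam_int 0 a) (hlam_int a b)
  have h2 : 0 ≤ ∫ t in a..b, lam t :=
    intervalIntegral.integral_nonneg hab (fun t _ => hlam_nonneg t)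
  rw [hΛ, hΛ]; linarith

lemma cumhaz_cont {lam Λ : ℝ → ℝ}
    (hlam_int : ∀ a b : ℝ, IntervalIntegrable lam volume a b)
    (hΛ : ∀ x, Λ x = ∫ t in (0:ℝ)..x, lam t) : Continuous Λ := by
  have : Λ = fun x => ∫ t in (0:ℝ)..x, lam t := funext hΛ
  rw [this]
  exact intervalIntegral.continuous_primitive hlam_int 0

lemma density_ftc {lam Λ : ℝ → ℝ} (hlam_nonneg : ∀ t, 0 ≤ lam t)
    (hlam_int : ∀ a b : ℝ, IntervalIntegrable lam volume a b)
    (hΛ : ∀ x, Λ x = ∫ t in (0:ℝ)..x, lam t) (w y : ℝ) (hy : 0 ≤ y) :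
    ∫ t in (0:ℝ)..y, lam t * (w * Real.exp (-(Λ t * w))) = 1 - Real.exp (-(Λ y * w)) := by
  have hmono := cumhaz_mono hlam_nonneg hlam_int hΛ
  have h0 : Λ 0 = 0 := by rw [hΛ]; simp
  have hAC : AbsolutelyContinuousOnInterval Λ 0 y := by
    have : Λ = fun x => ∫ t in (0:ℝ)..x, lam t := funext hΛ
    rw [this]
    exact (hlam_int 0 y).absolutelyContinuousOnInterval_intervalIntegral (by simp)
  have hcd : ContDiff ℝ 1 (fun u : ℝ => Real.exp (-(u * w))) := by fun_prop
  obtain ⟨K, hK⟩ := (hcd.contDiffOn (s := Set.Icc (0:ℝ) (Λ y))).exists_lipschitzOnWith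
    (by decide) (convex_Icc _ _) isCompact_Icc
  have hAC2 : AbsolutelyContinuousOnInterval (fun t => Real.exp (-(Λ t * w))) 0 y := by
    unfold AbsolutelyContinuousOnInterval at hAC
    refine squeeze_zero' ?_ ?_ (by simpa using hAC.const_mul (K:ℝ))
    · exact Filter.Eventually.of_forall <| fun _ ↦ Finset.sum_nonneg (fun i hi ↦ dist_nonneg)
    rw [Filter.eventually_inf_principal]
    filter_upwards with E hE
    rw [Finset.mul_sum]
    refine Finset.sum_le_sum fun i hi => ?_
    have hm := hE.1 i hi
    rw [Set.uIcc_of_le hy] at hm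
    have key : ∀ s ∈ Set.Icc 0 y, Λ s ∈ Set.Icc 0 (Λ y) := fun s hs =>
      ⟨h0 ▸ hmono hs.1, hmono hs.2⟩
    exact hK.dist_le_mul _ (key _ hm.1) _ (key _ hm.2)
  have hF := hAC2.integral_deriv_eq_sub
  have hcong : ∫ t in (0:ℝ)..y, deriv (fun t => Real.exp (-(Λ t * w))) t
      = ∫ t in (0:ℝ)..y, -(lam t * (w * Real.exp (-(Λ t * w)))) := by
    apply intervalIntegral.integral_congr_ae
    filter_upwards [(hlam_int 0 y).ae_hasDerivAt_integral] with t ht htm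
    have hd := ht (Set.uIoc_subset_uIcc htm) 0 (by simp)
    have hd' : HasDerivAt Λ (lam t) t := by
      have : Λ = fun x => ∫ t in (0:ℝ)..x, lam t := funext hΛ
      rw [this]; exact hd
    rw [((hd'.mul_const w).fun_neg.exp).deriv]
    ring
  rw [hcong, intervalIntegral.integral_neg, h0] at hF
  simp only [zero_mul, neg_zero, Real.exp_zero] at hF
  linarith

lemma map_restrict_eq {Ω : Type*} [MeasurableSpace Ω] (P : Measure Ω) [IsProbabilityMeasure P]
    {lam Λ : ℝ → ℝ} (hlam_meas : Measurable lam) (hlam_nonneg : ∀ t, 0 ≤ lam t)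
    (hlam_int : ∀ a b : ℝ, IntervalIntegrable lam volume a b)
    (hΛ : ∀ x, Λ x = ∫ t in (0:ℝ)..x, lam t) (w : ℝ) (hw : 0 < w)
    (X : Ω → ℝ≥0∞) (hX : Measurable X)
    (hXlaw : ∀ t : ℝ, 0 ≤ t →
      P {ω | ENNReal.ofReal t < X ω} = ENNReal.ofReal (Real.exp (-(Λ t * w))))
    (x : ℝ) (hx : 0 ≤ x) :
    (P.map X).restrict (Set.Iic (ENNReal.ofReal x)) =
      ((volume.restrict (Set.Ioc 0 x)).withDensity
        (fun t => ENNReal.ofReal (lam t * (w * Real.exp (-(Λ t * w)))))).map ENNReal.ofReal := by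
  have hcont := cumhaz_cont hlam_int hΛ
  have := hcont.measurable
  have : IsProbabilityMeasure (P.map X) := Measure.isProbabilityMeasure_map hX.aemeasurable
  refine Measure.ext_of_Iic _ _ fun a => ?_
  rw [Measure.restrict_apply measurableSet_Iic, Measure.map_apply ENNReal.measurable_ofReal
    measurableSet_Iic, withDensity_apply _ (ENNReal.measurable_ofReal measurableSet_Iic),
    Measure.restrict_restrict (ENNReal.measurable_ofReal measurableSet_Iic), Set.Iic_inter_Iic,
    Measure.map_apply hX measurableSet_Iic]
  have hfin : min a (ENNReal.ofReal x) ≠ ⊤ := ne_top_of_le_ne_top ENNReal.ofReal_ne_top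
    (min_le_right _ _)
  obtain ⟨y, hy0, hy⟩ : ∃ y : ℝ, 0 ≤ y ∧ min a (ENNReal.ofReal x) = ENNReal.ofReal y :=
    ⟨_, ENNReal.toReal_nonneg, (ENNReal.ofReal_toReal hfin).symm⟩
  have hset : ENNReal.ofReal ⁻¹' Set.Iic a ∩ Set.Ioc 0 x = Set.Ioc 0 y := by
    ext s
    simp only [Set.mem_inter_iff, Set.mem_preimage, Set.mem_Iic, Set.mem_Ioc]
    rw [← ENNReal.ofReal_le_ofReal_iff (p := s) hx, ← ENNReal.ofReal_le_ofReal_iff (p := s) hy0,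
      ← hy, le_min_iff]
    tauto
  rw [hset, hy]
  have hint : IntegrableOn (fun t => lam t * (w * Real.exp (-(Λ t * w)))) (Set.Ioc 0 y) := by
    have := (hlam_int 0 y).mul_continuousOn
      (g := fun t => w * Real.exp (-(Λ t * w))) (by fun_prop)
    exact (intervalIntegrable_iff_integrableOn_Ioc_of_le hy0).1 this
  rw [← ofReal_integral_eq_lintegral_ofReal hint
    (Filter.Eventually.of_forall fun t => by have := hlam_nonneg t; positivity),
    ← intervalIntegral.integral_of_le hy0, density_ftc hlam_nonneg hlam_int hΛ w y hy0,
    ENNReal.ofReal_sub _ (Real.exp_pos _).le, ← hXlaw y hy0, ENNReal.ofReal_one,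
    ← prob_compl_eq_one_sub (measurableSet_lt measurable_const hX)]
  congr 1
  ext ω
  simp

lemma lintegral_key {Ω : Type*} [MeasurableSpace Ω] (P : Measure Ω) [IsProbabilityMeasure P]
    {lam Λ : ℝ → ℝ} (hlam_meas : Measurable lam) (hlam_nonneg : ∀ t, 0 ≤ lam t)
    (hlam_int : ∀ a b : ℝ, IntervalIntegrable lam volume a b)
    (hΛ : ∀ x, Λ x = ∫ t in (0:ℝ)..x, lam t) (w : ℝ) (hw : 0 < w)
    (X C : Ω → ℝ≥0∞) (hX : Measurable X) (hC : Measurable C) (hind : IndepFun X C P)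
    (hXlaw : ∀ t : ℝ, 0 ≤ t →
      P {ω | ENNReal.ofReal t < X ω} = ENNReal.ofReal (Real.exp (-(Λ t * w))))
    (x : ℝ) (hx : 0 ≤ x) (G : ℝ≥0∞ → ℝ≥0∞) (hG : Measurable G) :
    ∫⁻ ω, (if X ω ≤ C ω ∧ min (X ω) (C ω) ≤ ENNReal.ofReal x then G (min (X ω) (C ω)) else 0) ∂P
    = ∫⁻ t in Set.Ioc 0 x, ENNReal.ofReal (lam t * (w * Real.exp (-(Λ t * w)))) *
        (G (ENNReal.ofReal t) * P {ω | ENNReal.ofReal t ≤ C ω}) := by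
  have := (cumhaz_cont hlam_int hΛ).measurable
  have : IsProbabilityMeasure (P.map X) := Measure.isProbabilityMeasure_map hX.aemeasurable
  have : IsProbabilityMeasure (P.map C) := Measure.isProbabilityMeasure_map hC.aemeasurable
  let F : ℝ≥0∞ × ℝ≥0∞ → ℝ≥0∞ := fun p =>
    if p.1 ≤ p.2 ∧ p.1 ≤ ENNReal.ofReal x then G p.1 else 0
  have hF : Measurable F := by
    refine Measurable.ite ?_ (by fun_prop) measurable_const
    exact (measurableSet_le measurable_fst measurable_snd).inter
      (measurableSet_le measurable_fst measurable_const)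
  have hanti : Antitone (fun a : ℝ≥0∞ => P.map C (Set.Ici a)) := fun a b hab =>
    measure_mono (Set.Ici_subset_Ici.2 hab)
  have hHm : Measurable (fun a : ℝ≥0∞ => G a * P.map C (Set.Ici a)) := hG.mul hanti.measurable
  calc _ = ∫⁻ ω, F (X ω, C ω) ∂P := by
        refine lintegral_congr fun ω => ?_
        by_cases h : X ω ≤ C ω <;> simp [F, h]
    _ = ∫⁻ p, F p ∂((P.map X).prod (P.map C)) := by
        rw [← (indepFun_iff_map_prod_eq_prod_map_map hX.aemeasurable hC.aemeasurable).1 hind,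
          lintegral_map hF (hX.prodMk hC)]
    _ = ∫⁻ a, ∫⁻ c, F (a, c) ∂(P.map C) ∂(P.map X) := lintegral_prod _ hF.aemeasurable
    _ = ∫⁻ a, (Set.Iic (ENNReal.ofReal x)).indicator
          (fun a => G a * P.map C (Set.Ici a)) a ∂(P.map X) := by
        refine lintegral_congr fun a => ?_
        by_cases h : a ≤ ENNReal.ofReal x
        · rw [Set.indicator_of_mem (by exact h), ← lintegral_indicator_const measurableSet_Ici]
          refine lintegral_congr fun c => ?_
          by_cases h' : a ≤ c <;> simp [F, h, h']
        · rw [Set.indicator_of_notMem (by exact h)]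
          simp [F, h]
    _ = _ := by
        rw [lintegral_indicator measurableSet_Iic, map_restrict_eq P hlam_meas hlam_nonneg
          hlam_int hΛ w hw X hX hXlaw x hx, lintegral_map hHm ENNReal.measurable_ofReal,
          lintegral_withDensity_eq_lintegral_mul _ (by fun_prop)
            (show Measurable (fun t : ℝ => G (ENNReal.ofReal t) *
              P.map C (Set.Ici (ENNReal.ofReal t))) from hHm.comp ENNReal.measurable_ofReal)]
        refine lintegral_congr fun t => ?_
        simp only [Pi.mul_apply]
        rw [Measure.map_apply hC measurableSet_Ici]
        rfl

lemma integral_key {Ω : Type*} [MeasurableSpace Ω] (P : Measure Ω) [IsProbabilityMeasure P]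
    {lam Λ : ℝ → ℝ} (hlam_meas : Measurable lam) (hlam_nonneg : ∀ t, 0 ≤ lam t)
    (hlam_int : ∀ a b : ℝ, IntervalIntegrable lam volume a b)
    (hΛ : ∀ x, Λ x = ∫ t in (0:ℝ)..x, lam t) (w : ℝ) (hw : 0 < w)
    (X C : Ω → ℝ≥0∞) (hX : Measurable X) (hC : Measurable C) (hind : IndepFun X C P)
    (hXlaw : ∀ t : ℝ, 0 ≤ t →
      P {ω | ENNReal.ofReal t < X ω} = ENNReal.ofReal (Real.exp (-(Λ t * w))))
    (S : ℝ → ℝ) (hSm : Measurable S) (hS : ∀ t, (P {ω | ENNReal.ofReal t ≤ C ω}).toReal = S t)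
    (x : ℝ) (hx : 0 ≤ x) (g : ℝ → ℝ) (hg : Measurable g) (hg0 : ∀ t, 0 ≤ g t) :
    ∫ ω, (if X ω ≤ C ω ∧ min (X ω) (C ω) ≤ ENNReal.ofReal x
      then g (min (X ω) (C ω)).toReal else 0) ∂P
    = ∫ t in (0:ℝ)..x, lam t * (w * Real.exp (-(Λ t * w)) * S t * g t) := by
  have hΛm := (cumhaz_cont hlam_int hΛ).measurable
  have hS0 : ∀ t, 0 ≤ S t := fun t => by rw [← hS]; exact ENNReal.toReal_nonneg
  rw [intervalIntegral.integral_of_le hx, integral_eq_lintegral_of_nonneg_ae,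
    integral_eq_lintegral_of_nonneg_ae]
  · congr 1
    have h := lintegral_key P hlam_meas hlam_nonneg hlam_int hΛ w hw X C hX hC hind hXlaw x hx
      (fun a => ENNReal.ofReal (g a.toReal)) (by fun_prop)
    refine (Eq.trans ?_ h).trans ?_
    · refine lintegral_congr fun ω => ?_
      split_ifs <;> simp
    · refine setLIntegral_congr_fun measurableSet_Ioc fun t ht => ?_
      have h1 := hlam_nonneg t
      have h2 := hS0 t
      have h3 := hg0 t
      rw [ENNReal.toReal_ofReal ht.1.le, ← ENNReal.ofReal_toReal (measure_ne_top P _), hS,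
        ← ENNReal.ofReal_mul h3, ← ENNReal.ofReal_mul (by positivity)]
      congr 1
      ring
  · refine Filter.Eventually.of_forall fun t => ?_
    have h1 := hlam_nonneg t
    have h2 := hS0 t
    have h3 := hg0 t
    simp only [Pi.zero_apply]
    positivity
  · exact Measurable.aestronglyMeasurable (by fun_prop)
  · refine Filter.Eventually.of_forall fun ω => ?_
    simp only [Pi.zero_apply]
    split_ifs
    exacts [hg0 _, le_rfl]
  · refine Measurable.aestronglyMeasurable ?_
    refine Measurable.ite ?_ (by fun_prop) measurable_const
    exact (measurableSet_le hX hC).inter (measurableSet_le (hX.min hC) measurable_const)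

/-- generic form of the bootstrap Breslow representation.
Weights `w_i > 0`, a baseline hazard `λ ≥ 0` with cumulative hazard `Λ(x) = ∫₀^x λ`;
event times `X_i` with `P(X_i > t) = exp(−Λ(t)·w_i)`, independent of censoring times
`C_i` distributed as `C` (all with values in `(0,∞]`, modelled in `ℝ≥0∞`). With
`T_i = min(X_i, C_i)`, `Δ_i = 1{X_i ≤ C_i}` and
`Φ*(t) = (1/n)Σ_j w_j·exp(−Λ(t)w_j)·P(C ≥ t)`, for every `x ≥ 0` with `P(C ≥ x) > 0`:
(i) `(1/n)Σ_i E[Δ_i·1{T_i ≤ x}/Φ*(T_i)] = Λ(x)`;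
(ii) `H*(x) = (1/n)Σ_i P(T_i ≤ x, Δ_i = 1) = ∫₀^x λ(t)·Φ*(t) dt`. -/
theorem bootstrap_breslow_representation
    {Ω : Type*} [MeasureSpace Ω] [IsProbabilityMeasure (ℙ : Measure Ω)]
    (n : ℕ) (hn : 1 ≤ n) (w : Fin n → ℝ) (hw : ∀ i, 0 < w i)
    (lam : ℝ → ℝ) (hlam_meas : Measurable lam) (hlam_nonneg : ∀ t, 0 ≤ lam t)
    (hlam_int : ∀ a b : ℝ, IntervalIntegrable lam volume a b)
    (Λ : ℝ → ℝ) (hΛ : ∀ x, Λ x = ∫ t in (0:ℝ)..x, lam t)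
    (X Cc : Fin n → Ω → ℝ≥0∞) (C : Ω → ℝ≥0∞)
    (hXmeas : ∀ i, Measurable (X i)) (hCcmeas : ∀ i, Measurable (Cc i))
    (hCmeas : Measurable C)
    (hindep : ∀ i, IndepFun (X i) (Cc i) ℙ)
    (hXlaw : ∀ i, ∀ t : ℝ, 0 ≤ t →
      ℙ {ω | ENNReal.ofReal t < X i ω} = ENNReal.ofReal (Real.exp (-(Λ t * w i))))
    (hClaw : ∀ i, Measure.map (Cc i) ℙ = Measure.map C ℙ)
    (Φs : ℝ → ℝ)
    (hΦs : ∀ t, Φs t = (1 / (n:ℝ)) * ∑ j, w j * Real.exp (-(Λ t * w j))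
      * (ℙ {ω | ENNReal.ofReal t ≤ C ω}).toReal)
    (x : ℝ) (hx : 0 ≤ x) (hxC : 0 < ℙ {ω | ENNReal.ofReal x ≤ C ω}) :
    ((1 / (n:ℝ)) * ∑ i, ∫ ω,
        (if X i ω ≤ Cc i ω ∧ min (X i ω) (Cc i ω) ≤ ENNReal.ofReal x
          then 1 / Φs ((min (X i ω) (Cc i ω)).toReal) else 0) ∂ℙ) = Λ x
    ∧ (1 / (n:ℝ)) * ∑ i,
        (ℙ {ω | min (X i ω) (Cc i ω) ≤ ENNReal.ofReal x ∧ X i ω ≤ Cc i ω}).toReal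
      = ∫ t in (0:ℝ)..x, lam t * Φs t := by
  have hcont := cumhaz_cont hlam_int hΛ
  have hΛm := hcont.measurable
  have hmono := cumhaz_mono hlam_nonneg hlam_int hΛ
  have hn0 : (0:ℝ) < n := by exact_mod_cast hn
  set S : ℝ → ℝ := fun t => ((ℙ : Measure Ω) {ω | ENNReal.ofReal t ≤ C ω}).toReal with hSdef
  have hSanti : Antitone S := fun a b hab => by
    refine ENNReal.toReal_mono (measure_ne_top _ _) (measure_mono fun ω hω => ?_)
    exact (ENNReal.ofReal_le_ofReal hab).trans hω
  have hSm : Measurable S := hSanti.measurable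
  have hS0 : ∀ t, 0 ≤ S t := fun t => ENNReal.toReal_nonneg
  have hS1 : ∀ t, S t ≤ 1 := fun t => by
    simpa [S] using ENNReal.toReal_mono ENNReal.one_ne_top
      (prob_le_one (μ := (ℙ : Measure Ω)) (s := {ω | ENNReal.ofReal t ≤ C ω}))
  have hSx : 0 < S x := ENNReal.toReal_pos hxC.ne' (measure_ne_top _ _)
  have hS : ∀ i t, ((ℙ : Measure Ω) {ω | ENNReal.ofReal t ≤ Cc i ω}).toReal = S t := by
    intro i t
    have h1 := Measure.map_apply (μ := (ℙ : Measure Ω)) (hCcmeas i)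
      (measurableSet_Ici (a := ENNReal.ofReal t))
    have h2 := Measure.map_apply (μ := (ℙ : Measure Ω)) hCmeas
      (measurableSet_Ici (a := ENNReal.ofReal t))
    rw [hClaw i, h2] at h1
    exact congrArg ENNReal.toReal h1.symm
  have hΦ : ∀ t, Φs t = (1 / (n:ℝ)) * ∑ j, w j * Real.exp (-(Λ t * w j)) * S t := hΦs
  have hΦm : Measurable Φs := by
    rw [funext hΦ]; fun_prop
  have hterm0 : ∀ j t, 0 ≤ w j * Real.exp (-(Λ t * w j)) * S t := fun j t => by
    have := hw j; have := hS0 t; positivity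
  have hΦ0 : ∀ t, 0 ≤ Φs t := fun t => by
    rw [hΦ]; exact mul_nonneg (by positivity) (Finset.sum_nonneg fun j _ => hterm0 j t)
  have hΦpos : ∀ t ≤ x, 0 < Φs t := fun t ht => by
    rw [hΦ]
    refine mul_pos (by positivity) (Finset.sum_pos (fun j _ => ?_) ⟨⟨0, hn⟩, Finset.mem_univ _⟩)
    have := hw j; have := hSx.trans_le (hSanti ht); positivity
  have hle : ∀ j t, w j * Real.exp (-(Λ t * w j)) * S t ≤ n * Φs t := fun j t => by
    rw [hΦ, ← mul_assoc, mul_one_div_cancel hn0.ne', one_mul]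
    exact Finset.single_le_sum (f := fun j => w j * Real.exp (-(Λ t * w j)) * S t)
      (fun j _ => hterm0 j t) (Finset.mem_univ j)
  have hII : ∀ f : ℝ → ℝ, Measurable f → ∀ K : ℝ, (∀ t ∈ Set.Ioc 0 x, |f t| ≤ K) →
      IntervalIntegrable (fun t => lam t * f t) volume 0 x := by
    intro f hf K hK
    rw [intervalIntegrable_iff_integrableOn_Ioc_of_le hx]
    have hl := ((intervalIntegrable_iff_integrableOn_Ioc_of_le hx).1 (hlam_int 0 x)).mul_const K
    refine Integrable.mono' hl (hlam_meas.mul hf).aestronglyMeasurable ?_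
    filter_upwards [ae_restrict_mem measurableSet_Ioc] with t ht
    rw [Real.norm_eq_abs, abs_mul, abs_of_nonneg (hlam_nonneg t)]
    exact mul_le_mul_of_nonneg_left (hK t ht) (hlam_nonneg t)
  constructor
  · have key : ∀ i, ∫ ω, (if X i ω ≤ Cc i ω ∧ min (X i ω) (Cc i ω) ≤ ENNReal.ofReal x
          then 1 / Φs ((min (X i ω) (Cc i ω)).toReal) else 0) ∂ℙ
        = ∫ t in (0:ℝ)..x, lam t * (w i * Real.exp (-(Λ t * w i)) * S t * (1 / Φs t)) :=
      fun i => integral_key ℙ hlam_meas hlam_nonneg hlam_int hΛ (w i) (hw i) (X i) (Cc i)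
        (hXmeas i) (hCcmeas i) (hindep i) (hXlaw i) S hSm (hS i) x hx (fun t => 1 / Φs t)
        (by fun_prop) (fun t => by have := hΦ0 t; positivity)
    rw [Finset.sum_congr rfl fun i _ => key i, ← intervalIntegral.integral_finsetSum,
      ← intervalIntegral.integral_const_mul, hΛ]
    · refine intervalIntegral.integral_congr_ae (Filter.Eventually.of_forall fun t ht => ?_)
      rw [Set.uIoc_of_le hx] at ht
      have hp := hΦpos t ht.2
      rw [← Finset.mul_sum, ← Finset.sum_mul]
      have : ∑ j, w j * Real.exp (-(Λ t * w j)) * S t = n * Φs t := by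
        rw [hΦ, ← mul_assoc, mul_one_div_cancel hn0.ne', one_mul]
      rw [this]
      field_simp
    · intro i _
      refine hII _ (by fun_prop) n fun t ht => ?_
      have hp := hΦpos t ht.2
      rw [abs_of_nonneg (mul_nonneg (hterm0 i t) (by positivity)), mul_one_div, div_le_iff₀ hp]
      exact hle i t
  · have key : ∀ i, ((ℙ : Measure Ω) {ω | min (X i ω) (Cc i ω) ≤ ENNReal.ofReal x ∧
          X i ω ≤ Cc i ω}).toReal
        = ∫ t in (0:ℝ)..x, lam t * (w i * Real.exp (-(Λ t * w i)) * S t * 1) := by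
      intro i
      rw [← integral_key ℙ hlam_meas hlam_nonneg hlam_int hΛ (w i) (hw i) (X i) (Cc i)
        (hXmeas i) (hCcmeas i) (hindep i) (hXlaw i) S hSm (hS i) x hx (fun _ => 1)
        measurable_const (fun t => zero_le_one)]
      have hms : MeasurableSet {ω | min (X i ω) (Cc i ω) ≤ ENNReal.ofReal x ∧
          X i ω ≤ Cc i ω} :=
        (measurableSet_le ((hXmeas i).min (hCcmeas i)) measurable_const).inter
          (measurableSet_le (hXmeas i) (hCcmeas i))
      rw [← measureReal_def, ← integral_indicator_one hms]
      refine integral_congr_ae (Filter.Eventually.of_forall fun ω => ?_)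
      simp only [Set.indicator_apply, Set.mem_ofPred_eq, Pi.one_apply]
      exact if_congr and_comm rfl rfl
    rw [Finset.sum_congr rfl fun i _ => key i, ← intervalIntegral.integral_finsetSum,
      ← intervalIntegral.integral_const_mul]
    · refine intervalIntegral.integral_congr fun t _ => ?_
      rw [← Finset.mul_sum, hΦ]
      simp only [mul_one]
      ring
    · intro i _
      refine hII _ (by fun_prop) (w i) fun t ht => ?_
      rw [mul_one, abs_of_nonneg (hterm0 i t)]
      have hL : 0 ≤ Λ t := by
        have := hmono ht.1.le; rw [hΛ 0] at this; simpa using this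
      have he : Real.exp (-(Λ t * w i)) ≤ 1 := by
        rw [Real.exp_le_one_iff]; have := mul_nonneg hL (hw i).le; linarith
      have := hw i
      calc w i * Real.exp (-(Λ t * w i)) * S t ≤ w i * 1 * 1 := by
            gcongr
            exact hS1 t
        _ = w i := by ring
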